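/- arXiv:1905.07341 — 3 statements merged into one kernel-verified Lean document; each statement's English description precedes it below -/
import Mathlib

section
/- Let n ≥ 1, let E = ℝⁿ × ℝⁿ carry the Euclidean norm and the standard symplectic form ω, and let R > r > 0 and ε > 0 be given. Let φ : B_R → E be a symplectic map of class C¹ on the open ball B_R. Then there exist R' > r and a symplectic map ψ : B_{R'} → E of class C^∞ such that sup_{x ∈ B_r} ‖φ(x) − ψ(x)‖ ≤ ε. -/
open scoped RealInnerProductSpace ContDiff

noncomputable section

/-- `E = ℝⁿ × ℝⁿ`. -/
abbrev Esp (n : ℕ) : Type := EuclideanSpace ℝ (Fin n) × EuclideanSpace ℝ (Fin n)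

/-- The Euclidean norm on `E = ℝⁿ × ℝⁿ`. -/
def eucNorm {n : ℕ} (p : Esp n) : ℝ := Real.sqrt (‖p.1‖ ^ 2 + ‖p.2‖ ^ 2)

/-- The open Euclidean ball of radius `R` centered at `0` in `E`. -/
def eucBall (n : ℕ) (R : ℝ) : Set (Esp n) := {p | eucNorm p < R}

/-- The standard symplectic form `ω((x,ξ),(y,η)) = ⟪ξ,y⟫ − ⟪η,x⟫` on `E = ℝⁿ × ℝⁿ`. -/
def symplForm {n : ℕ} (u v : Esp n) : ℝ := ⟪u.2, v.1⟫ - ⟪v.2, u.1⟫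

open scoped Topology NNReal
open Set Filter Metric

universe u

section Nemytskii

variable {T : Type*} [TopologicalSpace T] [CompactSpace T]

/-- Pointwise application of a continuous family of continuous linear maps, as a continuous
linear map in the family. -/
def clmApplyCM (T : Type*) [TopologicalSpace T] [CompactSpace T] (E F : Type*)
    [NormedAddCommGroup E] [NormedSpace ℝ E] [NormedAddCommGroup F] [NormedSpace ℝ F] :
    C(T, E →L[ℝ] F) →L[ℝ] C(T, E) →L[ℝ] C(T, F) :=
  LinearMap.mkContinuous₂
    (LinearMap.mk₂ ℝ (fun (A : C(T, E →L[ℝ] F)) (h : C(T, E)) =>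
        (⟨fun t => A t (h t), by fun_prop⟩ : C(T, F)))
      (fun _ _ _ => by ext; simp) (fun _ _ _ => by ext; simp)
      (fun _ _ _ => by ext; simp) (fun _ _ _ => by ext; simp)) 1
    (fun A h => by
      rw [ContinuousMap.norm_le _ (by positivity)]
      intro t
      calc ‖A t (h t)‖ ≤ ‖A t‖ * ‖h t‖ := (A t).le_opNorm _
        _ ≤ 1 * ‖A‖ * ‖h‖ := by
          rw [one_mul]
          gcongr
          exacts [A.norm_coe_le_norm t, h.norm_coe_le_norm t])

variable {E F : Type u} [NormedAddCommGroup E] [NormedSpace ℝ E]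
  [NormedAddCommGroup F] [NormedSpace ℝ F]

@[simp] lemma clmApplyCM_apply (A : C(T, E →L[ℝ] F)) (h : C(T, E)) (t : T) :
    clmApplyCM T E F A h t = A t (h t) := rfl

lemma hasFDerivAt_postcomp {g : C(E, F)} {g' : C(E, E →L[ℝ] F)}
    (hg : ∀ x, HasFDerivAt g (g' x) x) (γ : C(T, E)) :
    HasFDerivAt (fun γ : C(T, E) => g.comp γ) (clmApplyCM T E F (g'.comp γ)) γ := by
  rw [hasFDerivAt_iff_isLittleO_nhds_zero, Asymptotics.isLittleO_iff]
  intro c hc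
  have hcont : Continuous fun γ : C(T, E) => g'.comp γ := g'.continuous_postcomp
  have hγ : ContinuousAt (fun γ : C(T, E) => g'.comp γ) γ := hcont.continuousAt
  obtain ⟨δ, hδ, H⟩ := (Metric.continuousAt_iff (α := C(T, E)) (β := C(T, E →L[ℝ] F))).1 hγ c hc
  filter_upwards [Metric.ball_mem_nhds (0 : C(T, E)) hδ] with h hh
  rw [mem_ball_zero_iff] at hh
  rw [ContinuousMap.norm_le _ (by positivity)]
  intro t
  have key := Convex.norm_image_sub_le_of_norm_hasFDerivWithin_le' (f := g) (f' := g')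
    (φ := g' (γ t)) (s := segment ℝ (γ t) (γ t + h t)) (C := c) (x := γ t) (y := γ t + h t)
    (fun x _ => (hg x).hasFDerivWithinAt) ?_ (convex_segment _ _) (left_mem_segment _ _ _)
    (right_mem_segment _ _ _)
  · rw [add_sub_cancel_left] at key
    exact key.trans (by gcongr; exact h.norm_coe_le_norm t)
  · intro x hx
    rw [segment_eq_image'] at hx
    obtain ⟨s, hs, rfl⟩ := hx
    have h1 : dist (γ + s • h) γ < δ := by
      rw [dist_eq_norm, add_sub_cancel_left, norm_smul, Real.norm_of_nonneg hs.1]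
      exact (mul_le_of_le_one_left (norm_nonneg _) hs.2).trans_lt hh
    have h2 := (ContinuousMap.dist_apply_le_dist t).trans (H h1).le
    rw [dist_eq_norm] at h2
    simpa using h2

/-- The superposition operator of a `C^n` map is `C^n` on spaces of continuous functions. -/
lemma contDiff_postcomp_nat (n : ℕ) : ∀ {F : Type u} [NormedAddCommGroup F] [NormedSpace ℝ F]
    (g : C(E, F)), ContDiff ℝ n g → ContDiff ℝ n (fun γ : C(T, E) => g.comp γ) := by
  induction n with
  | zero =>
    intro F _ _ g _
    rw [Nat.cast_zero, contDiff_zero]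
    exact g.continuous_postcomp
  | succ n ih =>
    intro F _ _ g hg
    rw [Nat.cast_add, Nat.cast_one, contDiff_succ_iff_hasFDerivAt] at hg ⊢
    obtain ⟨g', hg', hd⟩ := hg
    exact ⟨fun γ => clmApplyCM T E F ((⟨g', hg'.continuous⟩ : C(E, E →L[ℝ] F)).comp γ),
      (clmApplyCM T E F).contDiff.fun_comp (ih ⟨g', hg'.continuous⟩ hg'),
      hasFDerivAt_postcomp (g' := ⟨g', hg'.continuous⟩) hd⟩

lemma contDiff_postcomp {g : C(E, F)} (hg : ContDiff ℝ ∞ g) :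
    ContDiff ℝ ∞ (fun γ : C(T, E) => g.comp γ) :=
  contDiff_infty.2 fun n => contDiff_postcomp_nat n g (hg.of_le (by exact_mod_cast le_top))

end Nemytskii

section ContractionFixedPoint

variable {X F : Type*} [NormedAddCommGroup X] [NormedSpace ℝ X] [CompleteSpace X]
  [NormedAddCommGroup F] [NormedSpace ℝ F] [CompleteSpace F]

/-- The fixed point of a smooth family of uniform contractions depends smoothly on the
parameter. -/
lemma exists_contDiff_fixedPoint {G : X × F → F} (hG : ContDiff ℝ ∞ G) {K : ℝ≥0} (hK : K < 1)
    (hL : ∀ x, LipschitzWith K fun y => G (x, y)) :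
    ∃ Φ : X → F, ContDiff ℝ ∞ Φ ∧ ∀ x, G (x, Φ x) = Φ x := by
  have hc : ∀ x, ContractingWith K fun y => G (x, y) := fun x => ⟨hK, hL x⟩
  set Φ : X → F := fun x => (hc x).fixedPoint _ with hΦ
  have hfix : ∀ x, G (x, Φ x) = Φ x := fun x => (hc x).fixedPoint_isFixedPt
  have huniq : ∀ x y, G (x, y) = y → y = Φ x := fun x y h => (hc x).fixedPoint_unique h
  have hcontΦ : Continuous Φ := by
    rw [continuous_iff_continuousAt]
    intro x₀
    have h1 : Tendsto (fun x => dist (Φ x₀) (G (x, Φ x₀)) / (1 - K)) (𝓝 x₀) (𝓝 0) := by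
      have : Continuous fun x => dist (Φ x₀) (G (x, Φ x₀)) / (1 - (K : ℝ)) := by
        have := hG.continuous
        fun_prop
      have h2 := this.tendsto x₀
      simpa [hfix x₀] using h2
    rw [ContinuousAt, tendsto_iff_dist_tendsto_zero]
    refine squeeze_zero (fun _ => dist_nonneg) (fun x => ?_) h1
    rw [dist_comm]
    exact (hc x).dist_fixedPoint_le (Φ x₀)
  refine ⟨Φ, contDiff_iff_contDiffAt.2 fun x₀ => ?_, hfix⟩
  set f : X × F → F := fun p => p.2 - G p with hf
  have cdf : ContDiffAt ℝ ∞ f (x₀, Φ x₀) := (contDiff_snd.sub hG).contDiffAt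
  have hGd : HasFDerivAt G (fderiv ℝ G (x₀, Φ x₀)) (x₀, Φ x₀) :=
    (hG.differentiable (by simp) _).hasFDerivAt
  have hfd : fderiv ℝ f (x₀, Φ x₀) = .snd ℝ X F - fderiv ℝ G (x₀, Φ x₀) :=
    (hasFDerivAt_snd.sub hGd).fderiv
  set A := fderiv ℝ G (x₀, Φ x₀) ∘L .inr ℝ X F with hA
  have hAn : ‖A‖ < 1 := by
    have h1 : HasFDerivAt (fun y => G (x₀, y)) A (Φ x₀) :=
      hGd.comp (Φ x₀) (hasFDerivAt_prodMk_right x₀ (Φ x₀))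
    exact (h1.le_of_lipschitz (hL x₀)).trans_lt (by exact_mod_cast hK)
  have if₂ : (fderiv ℝ f (x₀, Φ x₀) ∘L .inr ℝ X F).IsInvertible := by
    have h1 : fderiv ℝ f (x₀, Φ x₀) ∘L .inr ℝ X F = 1 - A := by
      rw [hfd]; ext y; simp [hA]
    rw [h1]
    exact ⟨ContinuousLinearEquiv.unitsEquiv ℝ F (Units.oneSub A hAn), by ext; rfl⟩
  have h1 := cdf.eventually_apply_eq_iff_implicitFunction (by simp) if₂
  have h2 : Tendsto (fun x => (x, Φ x)) (𝓝 x₀) (𝓝 (x₀, Φ x₀)) :=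
    (continuous_id.prodMk hcontΦ).tendsto x₀
  refine (cdf.contDiffAt_implicitFunction (by simp) if₂).congr_of_eventuallyEq ?_
  filter_upwards [h2.eventually h1] with x hx
  exact (hx.1 (by simp [hf, hfix])).symm

end ContractionFixedPoint

section Flow

open unitInterval

variable {V : Type u} [NormedAddCommGroup V] [NormedSpace ℝ V] [CompleteSpace V]

/-- Extension of a curve on `[0, 1]` to the real line, constant outside of `[0, 1]`. -/
def extendCurve (γ : C(I, V)) : ℝ → V := IccExtend zero_le_one γ

omit [NormedSpace ℝ V] [CompleteSpace V] in
lemma continuous_extendCurve (γ : C(I, V)) : Continuous (extendCurve γ) := γ.continuous.Icc_extend'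

omit [NormedSpace ℝ V] [CompleteSpace V] in
lemma extendCurve_of_mem (γ : C(I, V)) {t : ℝ} (ht : t ∈ I) : extendCurve γ t = γ ⟨t, ht⟩ :=
  IccExtend_of_mem _ _ ht

omit [NormedSpace ℝ V] [CompleteSpace V] in
lemma norm_extendCurve_le (γ : C(I, V)) (t : ℝ) : ‖extendCurve γ t‖ ≤ ‖γ‖ :=
  γ.norm_coe_le_norm _

/-- The primitive of a curve on `[0, 1]`, as a continuous linear operator. -/
def primitiveCLM (V : Type u) [NormedAddCommGroup V] [NormedSpace ℝ V] [CompleteSpace V] :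
    C(I, V) →L[ℝ] C(I, V) :=
  LinearMap.mkContinuous
    { toFun := fun γ => ⟨fun t => ∫ s in (0 : ℝ)..t, extendCurve γ s,
        (intervalIntegral.continuous_primitive
          (fun _ _ => (continuous_extendCurve γ).intervalIntegrable _ _) 0).comp
          continuous_subtype_val⟩
      map_add' := fun γ γ' => by
        ext t
        exact intervalIntegral.integral_add ((continuous_extendCurve γ).intervalIntegrable _ _)
          ((continuous_extendCurve γ').intervalIntegrable _ _)
      map_smul' := fun c γ => by
        ext t
        exact intervalIntegral.integral_smul c _ } 1
    (fun γ => by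
      rw [ContinuousMap.norm_le _ (by positivity)]
      intro t
      have h := intervalIntegral.norm_integral_le_of_norm_le_const (a := 0) (b := (t : ℝ))
        (f := extendCurve γ) (C := ‖γ‖) (fun s _ => norm_extendCurve_le γ s)
      refine h.trans ?_
      rw [sub_zero, abs_of_nonneg t.2.1, one_mul]
      exact mul_le_of_le_one_right (norm_nonneg _) t.2.2)

lemma primitiveCLM_apply (γ : C(I, V)) (t : I) :
    primitiveCLM V γ t = ∫ s in (0 : ℝ)..t, extendCurve γ s := rfl

lemma hasDerivAt_extendCurve_of_eq {γ δ : C(I, V)} {x : V}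
    (h : γ = ContinuousMap.const I x + primitiveCLM V δ) {t : ℝ} (ht : t ∈ Ioo (0 : ℝ) 1) :
    HasDerivAt (extendCurve γ) (extendCurve δ t) t := by
  have h1 : HasDerivAt (fun t => x + ∫ s in (0 : ℝ)..t, extendCurve δ s) (extendCurve δ t) t :=
    ((continuous_extendCurve δ).integral_hasStrictDerivAt 0 t).hasDerivAt.const_add x
  refine h1.congr_of_eventuallyEq ?_
  filter_upwards [Ioo_mem_nhds ht.1 ht.2] with s hs
  rw [extendCurve_of_mem _ (Ioo_subset_Icc_self hs), h]
  rfl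

lemma extendCurve_zero_of_eq {γ δ : C(I, V)} {x : V}
    (h : γ = ContinuousMap.const I x + primitiveCLM V δ) : extendCurve γ 0 = x := by
  rw [extendCurve_of_mem _ (⟨le_rfl, zero_le_one⟩ : (0 : ℝ) ∈ I), h]
  simp [primitiveCLM_apply]

/-- The graph of a curve on `[0, 1]`. -/
def graphCurve (γ : C(I, V)) : C(I, ℝ × V) := ⟨fun t => ((t : ℝ), γ t), by fun_prop⟩

omit [CompleteSpace V] in
lemma hasFDerivAt_graphCurve (γ : C(I, V)) :
    HasFDerivAt graphCurve ((ContinuousLinearMap.inr ℝ ℝ V).compLeftContinuous ℝ I) γ := by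
  have h : (graphCurve : C(I, V) → C(I, ℝ × V)) = fun γ =>
      (ContinuousLinearMap.inr ℝ ℝ V).compLeftContinuous ℝ I γ + graphCurve 0 := by
    ext γ t <;> simp [graphCurve]
  rw [h]
  exact (ContinuousLinearMap.hasFDerivAt _).add_const _

omit [CompleteSpace V] in
lemma contDiff_graphCurve : ContDiff ℝ ∞ (graphCurve : C(I, V) → C(I, ℝ × V)) := by
  have h : (graphCurve : C(I, V) → C(I, ℝ × V)) = fun γ =>
      (ContinuousLinearMap.inr ℝ ℝ V).compLeftContinuous ℝ I γ + graphCurve 0 := by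
    ext γ t <;> simp [graphCurve]
  rw [h]
  exact (ContinuousLinearMap.contDiff _).add contDiff_const

/-- Multiplication of curves by a continuous scalar function. -/
def mulCurveCLM (V : Type u) [NormedAddCommGroup V] [NormedSpace ℝ V] (a : C(I, ℝ)) :
    C(I, V) →L[ℝ] C(I, V) :=
  clmApplyCM I V V ⟨fun t => a t • ContinuousLinearMap.id ℝ V, by fun_prop⟩

/-- The solution curves of a smooth nonautonomous Lipschitz differential equation on `[0, 1]`
depend smoothly on the initial value, as elements of the space of continuous curves. -/
lemma exists_contDiff_solution {Y : C(ℝ × V, V)} (hY : ContDiff ℝ ∞ Y) {K : ℝ≥0}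
    (hK : ∀ t ∈ I, LipschitzWith K fun x => Y (t, x)) :
    ∃ Γ : V → C(I, V), ContDiff ℝ ∞ Γ ∧
      ∀ x, Γ x = ContinuousMap.const I x + primitiveCLM V (Y.comp (graphCurve (Γ x))) := by
  set L : ℝ := 2 * K + 1 with hL
  have hLpos : 0 < L := by positivity
  set P : C(I, V) →L[ℝ] C(I, V) := mulCurveCLM V ⟨fun t => Real.exp (L * t), by fun_prop⟩ with hP
  set Q : C(I, V) →L[ℝ] C(I, V) := mulCurveCLM V ⟨fun t => Real.exp (-(L * t)), by fun_prop⟩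
    with hQ
  have hPa : ∀ γ t, P γ t = Real.exp (L * t) • γ t := fun γ t => rfl
  have hQa : ∀ γ t, Q γ t = Real.exp (-(L * t)) • γ t := fun γ t => rfl
  have hPQ : ∀ γ, P (Q γ) = γ := fun γ => by
    ext t
    rw [hPa, hQa, smul_smul, ← Real.exp_add]
    simp
  set G : V × C(I, V) → C(I, V) := fun p =>
    Q (ContinuousLinearMap.const ℝ I p.1 + primitiveCLM V (Y.comp (graphCurve (P p.2)))) with hG
  have hGs : ContDiff ℝ ∞ G := by
    refine Q.contDiff.comp (ContDiff.add ?_ ((primitiveCLM V).contDiff.comp ?_))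
    · exact (ContinuousLinearMap.contDiff _).comp contDiff_fst
    · exact (contDiff_postcomp hY).comp (contDiff_graphCurve.comp (P.contDiff.comp contDiff_snd))
  have hGL : ∀ x, LipschitzWith (1 / 2) fun η => G (x, η) := by
    intro x
    refine LipschitzWith.of_dist_le_mul fun η η' => ?_
    rw [ContinuousMap.dist_le (by positivity)]
    intro t
    rw [dist_eq_norm]
    have e1 : G (x, η) t - G (x, η') t = Real.exp (-(L * t)) • ∫ s in (0 : ℝ)..t,
        (extendCurve (Y.comp (graphCurve (P η))) s
          - extendCurve (Y.comp (graphCurve (P η'))) s) := by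
      rw [intervalIntegral.integral_sub ((continuous_extendCurve _).intervalIntegrable _ _)
        ((continuous_extendCurve _).intervalIntegrable _ _), ← primitiveCLM_apply,
        ← primitiveCLM_apply, hG]
      simp only [hQa, ContinuousMap.add_apply, ← smul_sub, add_sub_add_left_eq_sub]
    rw [e1, norm_smul, Real.norm_of_nonneg (Real.exp_pos _).le]
    have hint : ∀ a b : ℝ, IntervalIntegrable
        (fun s => K * (Real.exp (L * s) * dist η η')) MeasureTheory.volume a b :=
      fun a b => (by fun_prop : Continuous _).intervalIntegrable _ _
    have e2 : ‖∫ s in (0 : ℝ)..t, (extendCurve (Y.comp (graphCurve (P η))) s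
          - extendCurve (Y.comp (graphCurve (P η'))) s)‖
        ≤ ∫ s in (0 : ℝ)..t, K * (Real.exp (L * s) * dist η η') := by
      refine intervalIntegral.norm_integral_le_of_norm_le t.2.1 ?_ (hint _ _)
      refine Filter.Eventually.of_forall fun s hs => ?_
      have hsI : s ∈ I := ⟨hs.1.le, hs.2.trans t.2.2⟩
      rw [extendCurve_of_mem _ hsI, extendCurve_of_mem _ hsI, ← dist_eq_norm]
      refine ((hK s hsI).dist_le_mul _ _).trans ?_
      gcongr
      rw [hPa, hPa, dist_smul₀, Real.norm_of_nonneg (Real.exp_pos _).le]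
      gcongr
      exact ContinuousMap.dist_apply_le_dist _
    have e3 : ∫ s in (0 : ℝ)..t, K * (Real.exp (L * s) * dist η η')
        = K / L * dist η η' * (Real.exp (L * t) - 1) := by
      rw [intervalIntegral.integral_eq_sub_of_hasDerivAt
        (f := fun s => K / L * dist η η' * Real.exp (L * s)) (fun s _ => ?_) (hint _ _)]
      · simp only [mul_zero, Real.exp_zero]
        ring
      · have := (((hasDerivAt_id s).const_mul L).exp).const_mul (K / L * dist η η')
        refine this.congr_deriv ?_
        simp only [id]
        field_simp
    have e4 : Real.exp (-(L * t)) * Real.exp (L * t) = 1 := by rw [← Real.exp_add]; simp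
    have e5 : (K : ℝ) / L ≤ 1 / 2 := by
      rw [div_le_div_iff₀ hLpos two_pos, hL]
      linarith
    have e6 : ((1 / 2 : ℝ≥0) : ℝ) = 1 / 2 := by norm_num
    rw [e6]
    refine (mul_le_mul_of_nonneg_left (e2.trans e3.le) (Real.exp_pos _).le).trans ?_
    have e7 : K / L * dist η η' ≤ 1 / 2 * dist η η' := by gcongr
    have e8 : 0 ≤ K / L * dist η η' := by positivity
    nlinarith [mul_nonneg e8 (Real.exp_pos (-(L * t))).le]
  obtain ⟨Φ, hΦ, hfix⟩ := exists_contDiff_fixedPoint hGs (by norm_num) hGL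
  refine ⟨fun x => P (Φ x), P.contDiff.comp hΦ, fun x => ?_⟩
  have h := congrArg P (hfix x)
  simp only [hG, hPQ] at h
  exact h.symm

/-- Existence of the flow of a smooth nonautonomous Lipschitz vector field on `[0, 1]`, with its
linearization. -/
lemma exists_smooth_flow {Y : ℝ × V → V} (hY : ContDiff ℝ ∞ Y) {K : ℝ≥0}
    (hK : ∀ t ∈ I, LipschitzWith K fun x => Y (t, x)) :
    ∃ (γ : V → ℝ → V) (A : V → ℝ → V →L[ℝ] V), ContDiff ℝ ∞ (fun x => γ x 1) ∧
      ∀ x, HasFDerivAt (fun x => γ x 1) (A x 1) x ∧ γ x 0 = x ∧ Continuous (γ x) ∧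
        (∀ t ∈ Ioo (0 : ℝ) 1, HasDerivAt (γ x) (Y (t, γ x t)) t) ∧
        ∀ u, A x 0 u = u ∧ Continuous (fun t => A x t u) ∧
          ∀ t ∈ Ioo (0 : ℝ) 1, HasDerivAt (fun t => A x t u)
            (fderiv ℝ Y (t, γ x t) (0, A x t u)) t := by
  obtain ⟨Γ, hΓ, hfix⟩ := exists_contDiff_solution (Y := ⟨Y, hY.continuous⟩) hY hK
  have hev : ∀ x t, extendCurve (Γ x) t
      = ContinuousMap.evalCLM ℝ (projIcc (0 : ℝ) 1 zero_le_one t) (Γ x) := fun x t => rfl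
  have hΓd : ∀ x, HasFDerivAt Γ (fderiv ℝ Γ x) x := fun x =>
    (hΓ.differentiable (by simp) x).hasFDerivAt
  refine ⟨fun x => extendCurve (Γ x), fun x t =>
    ContinuousMap.evalCLM ℝ (projIcc (0 : ℝ) 1 zero_le_one t) ∘L fderiv ℝ Γ x, ?_, fun x => ?_⟩
  · simp only [hev]
    exact (ContinuousLinearMap.contDiff _).comp hΓ
  refine ⟨?_, extendCurve_zero_of_eq (hfix x), continuous_extendCurve _, fun t ht => ?_,
    fun u => ?_⟩
  · simp only [hev]
    exact (ContinuousLinearMap.hasFDerivAt _).comp x (hΓd x)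
  · have := hasDerivAt_extendCurve_of_eq (hfix x) ht
    rwa [extendCurve_of_mem (ContinuousMap.comp _ _) (Ioo_subset_Icc_self ht),
      ContinuousMap.comp_apply, graphCurve, ContinuousMap.coe_mk, ContinuousMap.coe_mk,
      ← extendCurve_of_mem (Γ x) (Ioo_subset_Icc_self ht)] at this
  · have hd : Continuous (fderiv ℝ Y) := hY.continuous_fderiv (by simp)
    have h1 : HasFDerivAt (fun x => ContinuousMap.const I x
        + primitiveCLM V ((⟨Y, hY.continuous⟩ : C(ℝ × V, V)).comp (graphCurve (Γ x))))
        (ContinuousLinearMap.const ℝ I + primitiveCLM V ∘L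
          clmApplyCM I (ℝ × V) V ((⟨fderiv ℝ Y, hd⟩ : C(ℝ × V, ℝ × V →L[ℝ] V)).comp
            (graphCurve (Γ x))) ∘L
          (ContinuousLinearMap.inr ℝ ℝ V).compLeftContinuous ℝ I ∘L fderiv ℝ Γ x) x := by
      refine ((ContinuousLinearMap.const ℝ I).hasFDerivAt).add
        ((primitiveCLM V).hasFDerivAt.comp x ?_)
      refine HasFDerivAt.comp (g := fun γ => (⟨Y, hY.continuous⟩ : C(ℝ × V, V)).comp γ) x
        (hasFDerivAt_postcomp (g := ⟨Y, hY.continuous⟩) (g' := ⟨fderiv ℝ Y, hd⟩)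
        (fun p => (hY.differentiable (by simp) p).hasFDerivAt) _) ?_
      exact (hasFDerivAt_graphCurve _).comp x (hΓd x)
    have h2 := (hΓd x).unique (by
      convert h1 using 1
      exact funext hfix)
    have h3 := congrArg (fun B : V →L[ℝ] C(I, V) => B u) h2
    have h4 : fderiv ℝ Γ x u = ContinuousMap.const I u + primitiveCLM V
        (clmApplyCM I (ℝ × V) V ((⟨fderiv ℝ Y, hd⟩ : C(ℝ × V, ℝ × V →L[ℝ] V)).comp
          (graphCurve (Γ x))) ((ContinuousLinearMap.inr ℝ ℝ V).compLeftContinuous ℝ I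
            (fderiv ℝ Γ x u))) := h3
    refine ⟨extendCurve_zero_of_eq h4, continuous_extendCurve (fderiv ℝ Γ x u), fun t ht => ?_⟩
    have h5 := hasDerivAt_extendCurve_of_eq h4 ht
    have htI : t ∈ I := Ioo_subset_Icc_self ht
    rw [extendCurve_of_mem (clmApplyCM _ _ _ _ _) htI, clmApplyCM_apply, ContinuousMap.comp_apply,
      graphCurve, ContinuousMap.coe_mk, ContinuousMap.coe_mk,
      ← extendCurve_of_mem (Γ x) htI] at h5
    have h6 : extendCurve (fderiv ℝ Γ x u) t = fderiv ℝ Γ x u ⟨t, htI⟩ :=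
      extendCurve_of_mem _ htI
    change HasDerivAt (extendCurve (fderiv ℝ Γ x u)) (fderiv ℝ Y (t, extendCurve (Γ x) t)
      (0, extendCurve (fderiv ℝ Γ x u) t)) t
    rw [h6]
    exact h5

end Flow

section Moser

open unitInterval

variable {V : Type u} [NormedAddCommGroup V] [NormedSpace ℝ V]

lemma contDiff_integral_param {F : Type u} [NormedAddCommGroup F] [NormedSpace ℝ F]
    [CompleteSpace F] {h : ℝ × V → F} (hh : ContDiff ℝ ∞ h) :
    ContDiff ℝ ∞ (fun x => ∫ t in (0 : ℝ)..1, h (t, x)) ∧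
      ∀ x u, fderiv ℝ (fun x => ∫ t in (0 : ℝ)..1, h (t, x)) x u
        = ∫ t in (0 : ℝ)..1, fderiv ℝ h (t, x) (0, u) := by
  have hd : Continuous (fderiv ℝ h) := hh.continuous_fderiv (by simp)
  set H : C(ℝ × V, F) := ⟨h, hh.continuous⟩
  set H' : C(ℝ × V, ℝ × V →L[ℝ] F) := ⟨fderiv ℝ h, hd⟩
  set ev : C(I, F) →L[ℝ] F := ContinuousMap.evalCLM ℝ (1 : I) ∘L primitiveCLM F
  have hev : ∀ (g : ℝ → F) (γ : C(I, F)), (∀ t : I, γ t = g t) →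
      ev γ = ∫ t in (0 : ℝ)..1, g t := by
    intro g γ hg
    change ∫ t in (0 : ℝ)..1, extendCurve γ t = _
    refine intervalIntegral.integral_congr fun t ht => ?_
    rw [uIcc_of_le zero_le_one] at ht
    rw [extendCurve_of_mem _ ht, hg]
  have heq : (fun x => ∫ t in (0 : ℝ)..1, h (t, x))
      = fun x => ev (H.comp (graphCurve (ContinuousLinearMap.const ℝ I x))) :=
    funext fun x => (hev _ _ fun _ => rfl).symm
  rw [heq]
  refine ⟨ev.contDiff.comp ((contDiff_postcomp hh).comp
    (contDiff_graphCurve.comp (ContinuousLinearMap.contDiff _))), fun x u => ?_⟩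
  have h1 : HasFDerivAt (fun x => ev (H.comp (graphCurve (ContinuousLinearMap.const ℝ I x))))
      (ev ∘L clmApplyCM I (ℝ × V) F (H'.comp (graphCurve (ContinuousLinearMap.const ℝ I x))) ∘L
        (ContinuousLinearMap.inr ℝ ℝ V).compLeftContinuous ℝ I ∘L ContinuousLinearMap.const ℝ I)
      x := by
    refine ev.hasFDerivAt.comp x (HasFDerivAt.comp (g := fun γ => H.comp γ) x
      (hasFDerivAt_postcomp (g := H) (g' := H')
        (fun p => (hh.differentiable (by simp) p).hasFDerivAt) _) ?_)
    exact HasFDerivAt.comp (g := graphCurve) x (hasFDerivAt_graphCurve _)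
      (ContinuousLinearMap.hasFDerivAt _)
  rw [h1.fderiv]
  exact hev (fun t => fderiv ℝ h (t, x) (0, u)) _ fun _ => rfl

lemma fderiv_alternating {U : V → V →L[ℝ] V →L[ℝ] ℝ} (hU : ContDiff ℝ ∞ U)
    (halt : ∀ x u v, U x u v = -U x v u) (x w u v : V) :
    fderiv ℝ U x w u v = -fderiv ℝ U x w v u := by
  have e : ∀ a b, HasFDerivAt (fun y => U y a b) (((fderiv ℝ U x).flip a).flip b) x :=
    fun a b => by
      have := (((hU.differentiable (by simp) x).hasFDerivAt).clm_apply
        (hasFDerivAt_const a _)).clm_apply (hasFDerivAt_const b _)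
      refine this.congr_fderiv ?_
      ext; simp
  have h := (e v u).neg
  rw [show (-fun y => U y v u) = fun y => U y u v from funext fun y => (halt y u v).symm] at h
  simpa using congrArg (fun B : V →L[ℝ] ℝ => B w) ((e u v).unique h)

/-- **Poincaré lemma** for smooth `2`-forms, with an estimate of the primitive. -/
lemma exists_primitive_of_closed {U : V → V →L[ℝ] V →L[ℝ] ℝ} (hU : ContDiff ℝ ∞ U)
    (halt : ∀ x u v, U x u v = -U x v u)
    (hclosed : ∀ x u v w, fderiv ℝ U x u v w + fderiv ℝ U x v w u + fderiv ℝ U x w u v = 0) :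
    ∃ α : V → V →L[ℝ] ℝ, ContDiff ℝ ∞ α ∧
      (∀ x u v, fderiv ℝ α x u v - fderiv ℝ α x v u = U x u v) ∧
      ∀ x κ, (∀ t ∈ I, ‖U (t • x)‖ ≤ κ) → ‖α x‖ ≤ κ * ‖x‖ := by
  set h : ℝ × V → V →L[ℝ] ℝ := fun p => p.1 • U (p.1 • p.2) p.2 with hh
  have hhs : ContDiff ℝ ∞ h := by fun_prop
  obtain ⟨hα, hαd⟩ := contDiff_integral_param hhs
  refine ⟨_, hα, fun x u v => ?_, fun x κ hκ => ?_⟩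
  · have hUd : ∀ x, HasFDerivAt U (fderiv ℝ U x) x := fun x =>
      (hU.differentiable (by simp) x).hasFDerivAt
    have hhd : ∀ t u v, fderiv ℝ h (t, x) (0, u) v
        = t * (t * fderiv ℝ U (t • x) u x v + U (t • x) u v) := by
      intro t u v
      have h1 : HasFDerivAt (fun y => h (t, y)) (fderiv ℝ h (t, x) ∘L .inr ℝ ℝ V) x :=
        (hhs.differentiable (by simp) _).hasFDerivAt.comp x (hasFDerivAt_prodMk_right t x)
      have h2 : HasFDerivAt (fun y : V => t • y) (t • ContinuousLinearMap.id ℝ V) x :=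
        (hasFDerivAt_id x).const_smul t
      have h2' : HasFDerivAt (fun y => U (t • y))
          (fderiv ℝ U (t • x) ∘L (t • ContinuousLinearMap.id ℝ V)) x :=
        HasFDerivAt.comp (g := U) (f := fun y => t • y) x (hUd (t • x)) h2
      have h3 := ((h2'.clm_apply (hasFDerivAt_id x)).const_smul t)
      have h4 := h1.unique h3
      have h5 := congrArg (fun B : V →L[ℝ] V →L[ℝ] ℝ => B u v) h4
      simp at h5
      rw [h5]
      ring
    have hcont : ∀ u, Continuous fun t : ℝ => fderiv ℝ h (t, x) (0, u) := fun u => by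
      have := hhs.continuous_fderiv (by simp)
      fun_prop
    have happ : ∀ u v, (∫ t in (0 : ℝ)..1, fderiv ℝ h (t, x) (0, u)) v
        = ∫ t in (0 : ℝ)..1, fderiv ℝ h (t, x) (0, u) v := fun u v =>
      ContinuousLinearMap.intervalIntegral_apply ((hcont u).intervalIntegrable _ _) v
    rw [hαd, hαd, happ, happ, ← intervalIntegral.integral_sub
      (((hcont u).clm_apply continuous_const).intervalIntegrable _ _)
      (((hcont v).clm_apply continuous_const).intervalIntegrable _ _)]
    have h6 : ∀ t : ℝ, HasDerivAt (fun t => t ^ 2 * U (t • x) u v)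
        (fderiv ℝ h (t, x) (0, u) v - fderiv ℝ h (t, x) (0, v) u) t := by
      intro t
      have h7 : HasDerivAt (fun t : ℝ => t • x) ((1 : ℝ) • x) t := (hasDerivAt_id t).smul_const x
      have h8 : HasDerivAt (fun t : ℝ => U (t • x)) (fderiv ℝ U (t • x) ((1 : ℝ) • x)) t :=
        HasFDerivAt.comp_hasDerivAt (l := U) (f := fun t => t • x) t (hUd (t • x)) h7
      have h9 := (h8.clm_apply (hasDerivAt_const t u)).clm_apply (hasDerivAt_const t v)
      refine ((hasDerivAt_pow 2 t).mul h9).congr_deriv ?_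
      have hc := hclosed (t • x) x v u
      simp only [hhd, map_zero, add_zero, one_smul]
      have a1 := halt (t • x) u v
      have a2 := fderiv_alternating hU halt (t • x) v x u
      have a3 := fderiv_alternating hU halt (t • x) x u v
      simp
      linear_combination t * a1 + t ^ 2 * a2 + t ^ 2 * a3 - t ^ 2 * hc
    rw [intervalIntegral.integral_eq_sub_of_hasDerivAt (fun t _ => h6 t)
      ((((hcont u).clm_apply continuous_const).sub
        ((hcont v).clm_apply continuous_const)).intervalIntegrable _ _)]
    simp
  · have h1 := intervalIntegral.norm_integral_le_of_norm_le_const (a := 0) (b := 1)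
      (f := fun t => h (t, x)) (C := κ * ‖x‖) (fun t ht => ?_)
    · simpa using h1
    · rw [uIoc_of_le zero_le_one] at ht
      have htI : t ∈ I := ⟨ht.1.le, ht.2⟩
      have h2 : ‖U (t • x) x‖ ≤ κ * ‖x‖ := (U (t • x)).le_of_opNorm_le (hκ t htI) x
      rw [hh, norm_smul, Real.norm_of_nonneg ht.1.le]
      exact (mul_le_of_le_one_left (norm_nonneg _) ht.2).trans h2

lemma norm_ringInverse_one_add_le {R : Type*} [NormedRing R] [NormOneClass R]
    [HasSummableGeomSeries R] {a : R} (ha : ‖a‖ ≤ 1 / 2) : ‖Ring.inverse (1 + a)‖ ≤ 2 := by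
  have h1 : IsUnit (1 + a) := by
    have := (Units.oneSub (-a) (by rw [norm_neg]; linarith)).isUnit
    simpa using this
  have h2 : Ring.inverse (1 + a) = 1 - a * Ring.inverse (1 + a) := by
    have := Ring.mul_inverse_cancel _ h1
    rw [add_mul, one_mul] at this
    exact eq_sub_of_add_eq this
  have h3 : ‖Ring.inverse (1 + a)‖ ≤ 1 + 1 / 2 * ‖Ring.inverse (1 + a)‖ := by
    conv_lhs => rw [h2]
    refine (norm_sub_le _ _).trans ?_
    rw [norm_one]
    gcongr
    exact (norm_mul_le _ _).trans (by gcongr)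
  linarith

/-- A smooth function of time and space that vanishes for `x` outside of a compact set is
Lipschitz in space, uniformly for `t ∈ [0, 1]`. -/
lemma exists_lipschitzWith_of_compact {Y : ℝ × V → V} (hY : ContDiff ℝ ∞ Y) {k : Set V}
    (hk : IsCompact k) (h0 : ∀ t, ∀ x ∉ k, Y (t, x) = 0) :
    ∃ K : ℝ≥0, ∀ t ∈ I, LipschitzWith K fun x => Y (t, x) := by
  have hd : Continuous (fderiv ℝ Y) := hY.continuous_fderiv (by simp)
  have hder : ∀ t x, HasFDerivAt (fun x => Y (t, x)) (fderiv ℝ Y (t, x) ∘L .inr ℝ ℝ V) x :=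
    fun t x => (hY.differentiable (by simp) _).hasFDerivAt.comp x (hasFDerivAt_prodMk_right t x)
  obtain ⟨C, hC⟩ := ((isCompact_Icc (a := (0 : ℝ)) (b := 1)).prod hk).exists_bound_of_continuousOn
    (f := fun p => fderiv ℝ Y p ∘L .inr ℝ ℝ V) (by fun_prop)
  refine ⟨C.toNNReal, fun t ht => lipschitzWith_of_nnnorm_fderiv_le
    (fun x => (hder t x).differentiableAt) fun x => ?_⟩
  rw [← NNReal.coe_le_coe, coe_nnnorm, Real.coe_toNNReal']
  by_cases hx : x ∈ k
  · rw [(hder t x).fderiv]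
    exact (hC (t, x) ⟨ht, hx⟩).trans (le_max_left _ _)
  · have h1 : (fun y => Y (t, y)) =ᶠ[𝓝 x] fun _ => 0 := by
      filter_upwards [hk.isClosed.isOpen_compl.mem_nhds hx] with y hy
      exact h0 t y hy
    rw [h1.fderiv_eq]
    simp

variable [CompleteSpace V]

/-- **Moser's trick**: a small closed perturbation `Ω + U` of a constant symplectic form `Ω` is
pulled back to `Ω` by a smooth map close to the identity. -/
lemma exists_pullback_eq_of_closed_of_small [Nontrivial V] (Ω : V ≃L[ℝ] (V →L[ℝ] ℝ))
    (hΩ : ∀ u v, Ω u v = -Ω v u) {U : V → V →L[ℝ] V →L[ℝ] ℝ} (hU : ContDiff ℝ ∞ U)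
    (halt : ∀ x u v, U x u v = -U x v u)
    (hclosed : ∀ x u v w, fderiv ℝ U x u v w + fderiv ℝ U x v w u + fderiv ℝ U x w u v = 0)
    {χ : V → ℝ} (hχ : ContDiff ℝ ∞ χ) (hχ01 : ∀ x, χ x ∈ I) {k : Set V} (hk : IsCompact k)
    (hχk : ∀ x ∉ k, χ x = 0) {S : Set V} (hS : IsOpen S) (hχS : ∀ x ∈ S, χ x = 1) {κ ρ : ℝ}
    (hκ0 : 0 ≤ κ) (hρ0 : 0 ≤ ρ) (hρ : ∀ x ∈ k, ‖x‖ ≤ ρ)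
    (hκ : ∀ x ∈ k, ∀ t ∈ I, ‖U (t • x)‖ ≤ κ)
    (hsmall : ‖(Ω.symm : (V →L[ℝ] ℝ) →L[ℝ] V)‖ * κ ≤ 1 / 2) :
    ∃ g : V → V, ContDiff ℝ ∞ g ∧
      (∀ x, ‖g x - x‖ ≤ 4 * ‖(Ω.symm : (V →L[ℝ] ℝ) →L[ℝ] V)‖ * κ * ρ) ∧
      ∀ x, Metric.closedBall x (4 * ‖(Ω.symm : (V →L[ℝ] ℝ) →L[ℝ] V)‖ * κ * ρ) ⊆ S → ∀ u v,
        Ω (fderiv ℝ g x u) (fderiv ℝ g x v) + U (g x) (fderiv ℝ g x u) (fderiv ℝ g x v)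
          = Ω u v := by
  obtain ⟨α, hα, hdα, hαn⟩ := exists_primitive_of_closed hU halt hclosed
  set J : (V →L[ℝ] ℝ) →L[ℝ] V := (Ω.symm : (V →L[ℝ] ℝ) →L[ℝ] V) with hJ
  set M : ℝ := 4 * ‖J‖ * κ * ρ with hM
  have hM0 : 0 ≤ M := by positivity
  set θ : ℝ → ℝ := fun t => Real.sin (Real.pi / 2 * t) with hθ
  set θ' : ℝ → ℝ := fun t => Real.cos (Real.pi / 2 * t) * (Real.pi / 2) with hθ'
  have hθd : ∀ t, HasDerivAt θ (θ' t) t := fun t => by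
    have h := ((hasDerivAt_id t).const_mul (Real.pi / 2)).sin
    refine h.congr_deriv ?_
    simp [hθ']
  have hθ1 : ∀ t, |θ t| ≤ 1 := fun t => Real.abs_sin_le_one _
  have hθ'2 : ∀ t, |θ' t| ≤ 2 := fun t => by
    rw [hθ', abs_mul, abs_of_pos (by positivity : (0 : ℝ) < Real.pi / 2)]
    have h1 := Real.abs_cos_le_one (Real.pi / 2 * t)
    have h2 := Real.pi_le_four
    have h3 := Real.pi_pos
    nlinarith
  have hθs : ContDiff ℝ ∞ θ := by fun_prop
  have hθs' : ContDiff ℝ ∞ θ' := by fun_prop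
  set B : ℝ × V → V →L[ℝ] V := fun p => (θ p.1 * χ p.2) • (J ∘L U p.2) with hB
  have hBs : ContDiff ℝ ∞ B := by fun_prop
  have hBn : ∀ p, ‖B p‖ ≤ 1 / 2 := by
    intro p
    by_cases hp : p.2 ∈ k
    · rw [hB, norm_smul, Real.norm_eq_abs, abs_mul, abs_of_nonneg (hχ01 _).1]
      have h1 := hκ _ hp 1 ⟨zero_le_one, le_rfl⟩
      rw [one_smul] at h1
      have h2 : ‖J ∘L U p.2‖ ≤ 1 / 2 :=
        ((J.opNorm_comp_le _).trans (by gcongr)).trans hsmall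
      have h3 : |θ p.1| * χ p.2 ≤ 1 := mul_le_one₀ (hθ1 _) (hχ01 _).1 (hχ01 _).2
      exact (mul_le_of_le_one_left (norm_nonneg _) h3).trans h2
    · simp [hB, hχk _ hp]
  have hunit : ∀ p, IsUnit (1 + B p) := fun p => by
    have := (Units.oneSub (-B p) (by rw [norm_neg]; linarith [hBn p])).isUnit
    simpa using this
  set Y : ℝ × V → V := fun p =>
    -(θ' p.1 * χ p.2) • Ring.inverse (1 + B p) (J (α p.2)) with hY
  have hYs : ContDiff ℝ ∞ Y := by
    have h1 : ContDiff ℝ ∞ fun p => Ring.inverse (1 + B p) := by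
      rw [contDiff_iff_contDiffAt]
      intro p
      obtain ⟨w, hw⟩ := hunit p
      have h2 : ContDiffAt ℝ ∞ Ring.inverse (1 + B p) := hw ▸ contDiffAt_ringInverse ℝ w
      exact ContDiffAt.comp (g := Ring.inverse) (f := fun p => 1 + B p) p h2
        (contDiff_const.add hBs).contDiffAt
    fun_prop
  have hYk : ∀ t, ∀ x ∉ k, Y (t, x) = 0 := fun t x hx => by simp [hY, hχk x hx]
  have hYn : ∀ p, ‖Y p‖ ≤ M := by
    intro p
    by_cases hp : p.2 ∈ k
    · have h1 : ‖α p.2‖ ≤ κ * ρ :=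
        (hαn _ κ (hκ _ hp)).trans (by gcongr; exact hρ _ hp)
      have h2 : ‖Ring.inverse (1 + B p) (J (α p.2))‖ ≤ 2 * (‖J‖ * (κ * ρ)) :=
        (ContinuousLinearMap.le_of_opNorm_le _ (norm_ringInverse_one_add_le (hBn p)) _).trans
          (by gcongr; exact (J.le_opNorm _).trans (by gcongr))
      rw [hY, norm_smul, norm_neg, Real.norm_eq_abs, abs_mul, abs_of_nonneg (hχ01 _).1]
      have h3 : |θ' p.1| * χ p.2 ≤ 2 :=
        (mul_le_of_le_one_right (abs_nonneg _) (hχ01 _).2).trans (hθ'2 _)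
      calc _ ≤ 2 * (2 * (‖J‖ * (κ * ρ))) := by gcongr
        _ = M := by rw [hM]; ring
    · rw [hYk p.1 p.2 hp, norm_zero]
      exact hM0
  have hYS : ∀ t, ∀ x ∈ S, Ω (Y (t, x)) + θ t • U x (Y (t, x)) = -θ' t • α x := by
    intro t x hx
    have h1 : Y (t, x) + B (t, x) (Y (t, x)) = -θ' t • J (α x) := by
      have h2 := congrArg (fun A : V →L[ℝ] V => A (-θ' t • J (α x)))
        (Ring.mul_inverse_cancel _ (hunit (t, x)))
      simp only [hY, hχS x hx, mul_one]
      rw [← map_smul]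
      exact h2
    have h3 := congrArg Ω h1
    have h4 : ∀ l, Ω (J l) = l := fun l => Ω.apply_symm_apply l
    refine Eq.trans ?_ (neg_smul (θ' t) (α x)).symm
    simpa [hB, hχS x hx, h4] using h3
  have hYd : ∀ t, ∀ x ∈ S, ∀ a b, Ω (fderiv ℝ Y (t, x) (0, a)) b
      + θ t * (fderiv ℝ U x a (Y (t, x)) b + U x (fderiv ℝ Y (t, x) (0, a)) b)
      = -θ' t * fderiv ℝ α x a b := by
    intro t x hx a b
    have h1 : HasFDerivAt (fun x => Y (t, x)) (fderiv ℝ Y (t, x) ∘L .inr ℝ ℝ V) x :=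
      (hYs.differentiable (by simp) _).hasFDerivAt.comp x (hasFDerivAt_prodMk_right t x)
    have h2 := ((Ω : V →L[ℝ] V →L[ℝ] ℝ).hasFDerivAt.comp x h1).add
      ((((hU.differentiable (by simp) x).hasFDerivAt).clm_apply h1).const_smul (θ t))
    have h3 := ((hα.differentiable (by simp) x).hasFDerivAt).const_smul (-θ' t)
    have h4 := h2.unique (h3.congr_of_eventuallyEq
      (by filter_upwards [hS.mem_nhds hx] with y hy using hYS t y hy))
    have h5 := congrArg (fun B : V →L[ℝ] V →L[ℝ] ℝ => B a b) h4
    simp at h5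
    linarith
  obtain ⟨K, hK⟩ := exists_lipschitzWith_of_compact hYs hk hYk
  obtain ⟨γ, A, hγs, hγ⟩ := exists_smooth_flow hYs hK
  have hnear : ∀ x, ∀ t ∈ I, ‖γ x t - x‖ ≤ M := by
    intro x t ht
    obtain ⟨-, h0, hc, hd, -⟩ := hγ x
    have hYc : Continuous fun s => Y (s, γ x s) := hYs.continuous.comp (by fun_prop)
    have h1 := intervalIntegral.integral_eq_sub_of_hasDerivAt_of_le ht.1 hc.continuousOn
      (fun s hs => hd s ⟨hs.1, hs.2.trans_le ht.2⟩) (hYc.intervalIntegrable _ _)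
    have h2 := intervalIntegral.norm_integral_le_of_norm_le_const (a := 0) (b := t)
      (f := fun s => Y (s, γ x s)) (C := M) (fun s _ => hYn _)
    rw [h1, h0, sub_zero, abs_of_nonneg ht.1] at h2
    exact h2.trans (mul_le_of_le_one_right hM0 ht.2)
  refine ⟨fun x => γ x 1, hγs, fun x => hnear x 1 ⟨zero_le_one, le_rfl⟩, fun x hx u v => ?_⟩
  obtain ⟨hA, h0, hc, hd, hlin⟩ := hγ x
  obtain ⟨hu0, huc, hud⟩ := hlin u
  obtain ⟨hv0, hvc, hvd⟩ := hlin v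
  rw [hA.fderiv]
  have hγS : ∀ t ∈ I, γ x t ∈ S := fun t ht => hx (by
    rw [mem_closedBall_iff_norm]; exact hnear x t ht)
  set F : ℝ → ℝ := fun t => Ω (A x t u) (A x t v) + θ t * U (γ x t) (A x t u) (A x t v) with hF
  have hFc : Continuous F := by
    have h1 := hU.continuous
    have h2 := hθs.continuous
    fun_prop
  have hFd : ∀ t ∈ Ioo (0 : ℝ) 1, HasDerivAt F 0 t := by
    intro t ht
    have e1 := ((Ω : V →L[ℝ] V →L[ℝ] ℝ).hasFDerivAt.comp_hasDerivAt t (hud t ht)).clm_apply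
      (hvd t ht)
    have e2 : HasDerivAt (fun t => U (γ x t)) (fderiv ℝ U (γ x t) (Y (t, γ x t))) t :=
      HasFDerivAt.comp_hasDerivAt (l := U) t (hU.differentiable (by simp) _).hasFDerivAt (hd t ht)
    have e3 := (hθd t).mul ((e2.clm_apply (hud t ht)).clm_apply (hvd t ht))
    refine (e1.add e3).congr_deriv ?_
    have hS' := hγS t (Ioo_subset_Icc_self ht)
    have d1 := hYd t _ hS' (A x t u) (A x t v)
    have d2 := hYd t _ hS' (A x t v) (A x t u)
    have d3 := hdα (γ x t) (A x t u) (A x t v)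
    have d4 := hclosed (γ x t) (A x t u) (Y (t, γ x t)) (A x t v)
    have d5 := fderiv_alternating hU halt (γ x t) (A x t v) (A x t u) (Y (t, γ x t))
    have d6 := fderiv_alternating hU halt (γ x t) (Y (t, γ x t)) (A x t v) (A x t u)
    have d7 := hΩ (A x t u) (fderiv ℝ Y (t, γ x t) (0, A x t v))
    have d8 := halt (γ x t) (A x t u) (fderiv ℝ Y (t, γ x t) (0, A x t v))
    simp
    linear_combination d1 - d2 - θ' t * d3 - θ t * d4 + θ t * d5 + θ t * d6 + d7 + θ t * d8
  obtain ⟨c, hc01, hcs⟩ := exists_hasDerivAt_eq_slope F (fun _ => 0) zero_lt_one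
    hFc.continuousOn hFd
  have hF01 : F 1 = F 0 := by linarith
  have hθ0 : θ 0 = 0 := by simp [hθ]
  have hθ1' : θ 1 = 1 := by simp [hθ]
  simpa [hF, hθ0, hθ1', hu0, hv0] using hF01

end Moser

section Pullback

variable {V : Type u} [NormedAddCommGroup V] [NormedSpace ℝ V]

/-- The bilinear form `(u, v) ↦ Ω (A u) (A v)`. -/
def pullbackForm (Ω : V →L[ℝ] V →L[ℝ] ℝ) (A : V →L[ℝ] V) : V →L[ℝ] V →L[ℝ] ℝ :=
  (ContinuousLinearMap.compL ℝ V V ℝ).flip A ∘L Ω ∘L A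

@[simp] lemma pullbackForm_apply (Ω : V →L[ℝ] V →L[ℝ] ℝ) (A : V →L[ℝ] V) (u v : V) :
    pullbackForm Ω A u v = Ω (A u) (A v) := rfl

lemma contDiff_pullbackForm (Ω : V →L[ℝ] V →L[ℝ] ℝ) {f : V → V} (hf : ContDiff ℝ ∞ f) :
    ContDiff ℝ ∞ fun x => pullbackForm Ω (fderiv ℝ f x) := by
  have h1 : ContDiff ℝ ∞ (fderiv ℝ f) := hf.fderiv_right (by simp)
  exact ((ContinuousLinearMap.contDiff _).comp h1).clm_comp (contDiff_const.clm_comp h1)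

/-- The pullback of a constant alternating form by a smooth map is closed. -/
lemma fderiv_pullbackForm_cyclic (Ω : V →L[ℝ] V →L[ℝ] ℝ) (hΩ : ∀ u v, Ω u v = -Ω v u)
    {f : V → V} (hf : ContDiff ℝ ∞ f) (x u v w : V) :
    fderiv ℝ (fun x => pullbackForm Ω (fderiv ℝ f x)) x u v w
      + fderiv ℝ (fun x => pullbackForm Ω (fderiv ℝ f x)) x v w u
      + fderiv ℝ (fun x => pullbackForm Ω (fderiv ℝ f x)) x w u v = 0 := by
  set D := fderiv ℝ f with hD
  have h1 : ContDiff ℝ ∞ D := hf.fderiv_right (by simp)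
  have hDx := (h1.differentiable (by simp) x).hasFDerivAt
  have hsymm : ∀ a b, fderiv ℝ D x a b = fderiv ℝ D x b a :=
    second_derivative_symmetric (fun y => (hf.differentiable (by simp) y).hasFDerivAt) hDx
  have key : ∀ a b c, fderiv ℝ (fun x => pullbackForm Ω (D x)) x a b c
      = Ω (fderiv ℝ D x a b) (D x c) + Ω (D x b) (fderiv ℝ D x a c) := by
    intro a b c
    have h2 := ((contDiff_pullbackForm Ω hf).differentiable (by simp) x).hasFDerivAt
    have h3 := (h2.clm_apply (hasFDerivAt_const b x)).clm_apply (hasFDerivAt_const c x)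
    have h4 := (Ω.hasFDerivAt.comp x (hDx.clm_apply (hasFDerivAt_const b x))).clm_apply
      (hDx.clm_apply (hasFDerivAt_const c x))
    have h5 := congrArg (fun l : V →L[ℝ] ℝ => l a) (h3.unique h4)
    simpa [add_comm] using h5
  rw [key, key, key, hsymm v w, hsymm w u, hsymm v u, hΩ (D x v), hΩ (D x w), hΩ (D x u)]
  ring

lemma norm_pullbackForm_sub_le (Ω : V →L[ℝ] V →L[ℝ] ℝ) {A B : V →L[ℝ] V} {M η : ℝ}
    (hB : ‖B‖ ≤ M) (hAB : ‖A - B‖ ≤ η) (hη : η ≤ 1) :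
    ‖pullbackForm Ω A - pullbackForm Ω B‖ ≤ ‖Ω‖ * (2 * M + 1) * η := by
  have hη0 := (norm_nonneg _).trans hAB
  have hM0 := (norm_nonneg _).trans hB
  have hA : ‖A‖ ≤ M + 1 := by
    calc ‖A‖ = ‖B + (A - B)‖ := by rw [add_sub_cancel]
      _ ≤ ‖B‖ + ‖A - B‖ := norm_add_le _ _
      _ ≤ M + 1 := by linarith
  refine ContinuousLinearMap.opNorm_le_bound₂ _ (by positivity) fun u v => ?_
  have h1 : (pullbackForm Ω A - pullbackForm Ω B) u v
      = Ω ((A - B) u) (A v) + Ω (B u) ((A - B) v) := by simp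
  rw [h1]
  calc ‖Ω ((A - B) u) (A v) + Ω (B u) ((A - B) v)‖
      ≤ ‖Ω‖ * ‖(A - B) u‖ * ‖A v‖ + ‖Ω‖ * ‖B u‖ * ‖(A - B) v‖ :=
        (norm_add_le _ _).trans (add_le_add (Ω.le_opNorm₂ _ _) (Ω.le_opNorm₂ _ _))
    _ ≤ ‖Ω‖ * (η * ‖u‖) * ((M + 1) * ‖v‖) + ‖Ω‖ * (M * ‖u‖) * (η * ‖v‖) := by
        gcongr
        · exact (A - B).le_of_opNorm_le hAB u
        · exact A.le_of_opNorm_le hA v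
        · exact B.le_of_opNorm_le hB u
        · exact (A - B).le_of_opNorm_le hAB v
    _ = ‖Ω‖ * (2 * M + 1) * η * ‖u‖ * ‖v‖ := by ring

end Pullback

section Approximation

open MeasureTheory

variable {V : Type u} [NormedAddCommGroup V] [NormedSpace ℝ V] [FiniteDimensional ℝ V]
  {F : Type*} [NormedAddCommGroup F] [NormedSpace ℝ F] [CompleteSpace F]

/-- Smooth functions are `C¹`-dense among compactly supported `C¹` functions. -/
lemma exists_contDiff_norm_fderiv_sub_le {φ : V → F} (hφ : ContDiff ℝ 1 φ)
    (hc : HasCompactSupport φ) {η : ℝ} (hη : 0 < η) :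
    ∃ f : V → F, ContDiff ℝ ∞ f ∧ ∀ x, ‖f x - φ x‖ ≤ η ∧ ‖fderiv ℝ f x - fderiv ℝ φ x‖ ≤ η := by
  borelize V
  have hDc := hφ.continuous_fderiv one_ne_zero
  obtain ⟨δ₁, hδ₁, h₁⟩ := Metric.uniformContinuous_iff.1
    (hc.uniformContinuous_of_continuous hφ.continuous) η hη
  obtain ⟨δ₂, hδ₂, h₂⟩ := Metric.uniformContinuous_iff.1
    ((hc.fderiv ℝ).uniformContinuous_of_continuous hDc) η hη
  have hδ := lt_min hδ₁ hδ₂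
  set b : ContDiffBump (0 : V) := ⟨min δ₁ δ₂ / 2, min δ₁ δ₂, half_pos hδ, half_lt_self hδ⟩
  have hloc := hφ.continuous.locallyIntegrable (μ := (Measure.addHaar : Measure V))
  refine ⟨_, b.hasCompactSupport_normed.contDiff_convolution_left (.lsmul ℝ ℝ)
    (b.contDiff_normed (μ := Measure.addHaar)) hloc, fun x => ⟨?_, ?_⟩⟩
  · rw [← dist_eq_norm]
    exact b.dist_normed_convolution_le hφ.continuous.aestronglyMeasurable
      fun y hy => (h₁ (hy.trans_le (min_le_left _ _))).le
  · have hL : (ContinuousLinearMap.lsmul ℝ ℝ : ℝ →L[ℝ] F →L[ℝ] F).precompR V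
        = ContinuousLinearMap.lsmul ℝ ℝ := by
      ext; simp [ContinuousLinearMap.precompR_apply]
    rw [(hc.hasFDerivAt_convolution_right (.lsmul ℝ ℝ)
      (b.continuous_normed (μ := Measure.addHaar)).locallyIntegrable hφ x).fderiv, hL,
      ← dist_eq_norm]
    exact b.dist_normed_convolution_le hDc.aestronglyMeasurable
      fun y hy => (h₂ (hy.trans_le (min_le_right _ _))).le

lemma exists_contDiff_one_nhds_of_subset_interior {s t : Set V} (hs : IsClosed s)
    (hst : s ⊆ interior t) :
    ∃ χ : V → ℝ, ContDiff ℝ ∞ χ ∧ (∀ᶠ x in 𝓝ˢ s, χ x = 1) ∧ (∀ x ∉ t, χ x = 0) ∧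
      ∀ x, χ x ∈ Icc 0 1 := by
  obtain ⟨χ, h1, h0, hI⟩ := exists_contMDiffMap_one_nhds_of_subset_interior
    (modelWithCornersSelf ℝ V) (n := ⊤) hs hst
  exact ⟨χ, χ.contMDiff.contDiff, h1, h0, hI⟩

omit [CompleteSpace F] in
lemma exists_contDiff_hasCompactSupport_eventuallyEq {φ : V → F} {O K : Set V} (hO : IsOpen O)
    (hφ : ContDiffOn ℝ 1 φ O) (hK : IsCompact K) (hKO : K ⊆ O) :
    ∃ φ' : V → F, ContDiff ℝ 1 φ' ∧ HasCompactSupport φ' ∧ ∀ x ∈ K, φ' =ᶠ[𝓝 x] φ := by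
  obtain ⟨L, hL, hKL, hLO⟩ := exists_compact_between hK hO hKO
  obtain ⟨χ, hχ, h1, h0, -⟩ := exists_contDiff_one_nhds_of_subset_interior hK.isClosed hKL
  refine ⟨fun x => χ x • φ x, ?_, ?_, fun x hx => ?_⟩
  · rw [contDiff_iff_contDiffAt]
    intro x
    by_cases hx : x ∈ L
    · exact (hχ.of_le (by simp)).contDiffAt.smul (hφ.contDiffAt (hO.mem_nhds (hLO hx)))
    · refine (contDiffAt_const (c := 0)).congr_of_eventuallyEq ?_
      filter_upwards [hL.isClosed.isOpen_compl.mem_nhds hx] with y hy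
      rw [h0 y hy, zero_smul]
  · exact HasCompactSupport.intro hL fun x hx => by rw [h0 x hx, zero_smul]
  · filter_upwards [h1.filter_mono (nhds_le_nhdsSet hx)] with y hy
    rw [hy, one_smul]

/-- A `C¹` map preserving a constant symplectic form near a star-shaped compact set can be
approximated, uniformly on a compact subset of the interior, by globally smooth maps
preserving the form there. -/
theorem exists_contDiff_symplectic_approx [Nontrivial V] (Ω : V ≃L[ℝ] (V →L[ℝ] ℝ))
    (hΩ : ∀ u v, Ω u v = -Ω v u) {φ : V → V} {O K K₀ : Set V} (hO : IsOpen O)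
    (hφ : ContDiffOn ℝ 1 φ O) (hsymp : ∀ x ∈ O, ∀ u v, Ω (fderiv ℝ φ x u) (fderiv ℝ φ x v) = Ω u v)
    (hK : IsCompact K) (hKO : K ⊆ O) (hstar : ∀ x ∈ K, ∀ t ∈ Icc (0 : ℝ) 1, t • x ∈ K)
    (hK₀ : IsCompact K₀) (hK₀K : K₀ ⊆ interior K) {ε : ℝ} (hε : 0 < ε) :
    ∃ ψ : V → V, ContDiff ℝ ∞ ψ ∧
      ∀ x ∈ K₀, (∀ u v, Ω (fderiv ℝ ψ x u) (fderiv ℝ ψ x v) = Ω u v) ∧ ‖ψ x - φ x‖ ≤ ε := by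
  have : CompleteSpace V := FiniteDimensional.complete ℝ V
  obtain ⟨φ', hφ', hc, hφφ'⟩ := exists_contDiff_hasCompactSupport_eventuallyEq hO hφ hK hKO
  obtain ⟨χ, hχ, hχ1, hχ0, hχI⟩ := exists_contDiff_one_nhds_of_subset_interior hK₀.isClosed hK₀K
  obtain ⟨S, hS, hK₀S, hχS⟩ := eventually_nhdsSet_iff_exists.1 hχ1
  have hSK : S ⊆ K := fun x hx => by
    by_contra h
    simpa [hχ0 x h] using hχS x hx
  obtain ⟨δ₀, hδ₀, hδS⟩ := hK₀.exists_cthickening_subset_open hS hK₀S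
  obtain ⟨δ₁, hδ₁, hδφ⟩ := Metric.uniformContinuous_iff.1
    (hc.uniformContinuous_of_continuous hφ'.continuous) (ε / 2) (half_pos hε)
  obtain ⟨M, hM⟩ := ((hc.fderiv ℝ).exists_bound_of_continuous (hφ'.continuous_fderiv one_ne_zero))
  obtain ⟨ρ, hρ0, hρ⟩ := hK.isBounded.exists_pos_norm_le
  set Ω' : V →L[ℝ] V →L[ℝ] ℝ := (Ω : V →L[ℝ] V →L[ℝ] ℝ) with hΩ'
  set J := (Ω.symm : (V →L[ℝ] ℝ) →L[ℝ] V) with hJ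
  obtain ⟨κ, hκ0, hκ1, hκ2⟩ : ∃ κ > 0, ‖J‖ * κ ≤ 1 / 2 ∧ 4 * ‖J‖ * κ * ρ < min δ₀ δ₁ := by
    obtain ⟨κ₁, h₁, h₁'⟩ := exists_pos_mul_lt (half_pos one_pos) ‖J‖
    obtain ⟨κ₂, h₂, h₂'⟩ := exists_pos_mul_lt (lt_min hδ₀ hδ₁) (4 * ‖J‖ * ρ)
    refine ⟨min κ₁ κ₂, lt_min h₁ h₂, ?_, ?_⟩
    · calc ‖J‖ * min κ₁ κ₂ ≤ ‖J‖ * κ₁ := by gcongr; exact min_le_left _ _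
        _ ≤ 1 / 2 := h₁'.le
    · calc 4 * ‖J‖ * min κ₁ κ₂ * ρ ≤ 4 * ‖J‖ * κ₂ * ρ := by gcongr; exact min_le_right _ _
        _ = 4 * ‖J‖ * ρ * κ₂ := by ring
        _ < min δ₀ δ₁ := h₂'
  obtain ⟨η₁, hη₁, hη₁κ⟩ := exists_pos_mul_lt hκ0 (‖Ω'‖ * (2 * M + 1))
  set η := min η₁ (min 1 (ε / 2)) with hη
  have hη0 : 0 < η := lt_min hη₁ (lt_min one_pos (half_pos hε))
  have hη1 : η ≤ 1 := (min_le_right _ _).trans (min_le_left _ _)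
  have hηε : η ≤ ε / 2 := (min_le_right _ _).trans (min_le_right _ _)
  have hM0 : 0 ≤ M := (norm_nonneg _).trans (hM 0)
  have hηκ : ‖Ω'‖ * (2 * M + 1) * η ≤ κ :=
    (mul_le_mul_of_nonneg_left (min_le_left _ _) (by positivity)).trans hη₁κ.le
  obtain ⟨f, hf, hfφ⟩ := exists_contDiff_norm_fderiv_sub_le hφ' hc hη0
  have hpull : ∀ x ∈ K, pullbackForm Ω' (fderiv ℝ φ' x) = Ω' := fun x hx => by
    ext u v
    rw [pullbackForm_apply, (hφφ' x hx).fderiv_eq]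
    exact hsymp x (hKO hx) u v
  have hU := (contDiff_pullbackForm Ω' hf).sub (contDiff_const (c := Ω'))
  have hdU : ∀ x, fderiv ℝ (fun x => pullbackForm Ω' (fderiv ℝ f x) - Ω') x
      = fderiv ℝ (fun x => pullbackForm Ω' (fderiv ℝ f x)) x := fun x =>
    (((contDiff_pullbackForm Ω' hf).differentiable (by simp) x).hasFDerivAt.sub_const Ω').fderiv
  obtain ⟨g, hg, hgx, hgΩ⟩ := exists_pullback_eq_of_closed_of_small Ω hΩ hU
    (fun x u v => by
      have h1 := hΩ u v
      have h2 := hΩ (fderiv ℝ f x u) (fderiv ℝ f x v)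
      simp only [sub_apply, pullbackForm_apply, hΩ', ContinuousLinearEquiv.coe_coe]
      linarith)
    (fun x u v w => by
      rw [hdU]
      exact fderiv_pullbackForm_cyclic Ω' hΩ hf x u v w)
    hχ hχI hK hχ0 hS hχS hκ0.le hρ0.le hρ
    (fun x hx t ht => by
      have h1 := norm_pullbackForm_sub_le Ω' (hM (t • x)) (hfφ (t • x)).2 hη1
      rw [hpull _ (hstar x hx t ht)] at h1
      exact h1.trans hηκ)
    hκ1
  refine ⟨f ∘ g, hf.comp hg, fun x hx => ?_⟩
  have hball : closedBall x (4 * ‖J‖ * κ * ρ) ⊆ S :=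
    (closedBall_subset_closedBall (hκ2.le.trans (min_le_left _ _))).trans
      ((closedBall_subset_cthickening hx δ₀).trans hδS)
  have hgS : g x ∈ S := hball (by rw [mem_closedBall, dist_eq_norm]; exact hgx x)
  refine ⟨fun u v => ?_, ?_⟩
  · rw [fderiv_comp x (hf.differentiable (by simp) _) (hg.differentiable (by simp) _)]
    have h1 := hgΩ x hball u v
    simp only [sub_apply, pullbackForm_apply, hΩ', ContinuousLinearEquiv.coe_coe] at h1
    simp only [ContinuousLinearMap.comp_apply]
    linarith
  · have h1 : ‖φ' (g x) - φ' x‖ < ε / 2 := by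
      rw [← dist_eq_norm]
      refine hδφ ?_
      rw [dist_eq_norm]
      exact (hgx x).trans_lt (hκ2.trans_le (min_le_right _ _))
    rw [← (hφφ' x (interior_subset (hK₀K hx))).eq_of_nhds]
    calc ‖f (g x) - φ' x‖ ≤ ‖f (g x) - φ' (g x)‖ + ‖φ' (g x) - φ' x‖ :=
          norm_sub_le_norm_sub_add_norm_sub _ _ _
      _ ≤ ε / 2 + ε / 2 := add_le_add ((hfφ _).1.trans hηε) h1.le
      _ = ε := add_halves ε

end Approximation

section EuclideanBall

variable {n : ℕ}

lemma continuous_eucNorm : Continuous (eucNorm : Esp n → ℝ) := by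
  unfold eucNorm; fun_prop

lemma norm_le_eucNorm (p : Esp n) : ‖p‖ ≤ eucNorm p :=
  max_le (Real.le_sqrt_of_sq_le (by nlinarith [sq_nonneg ‖p.2‖]))
    (Real.le_sqrt_of_sq_le (by nlinarith [sq_nonneg ‖p.1‖]))

lemma eucNorm_le (p : Esp n) : eucNorm p ≤ 2 * ‖p‖ := by
  have h1 := norm_fst_le p
  have h2 := norm_snd_le p
  refine Real.sqrt_le_iff.2 ⟨by positivity, ?_⟩
  nlinarith [norm_nonneg p.1, norm_nonneg p.2]

lemma eucNorm_smul (t : ℝ) (p : Esp n) : eucNorm (t • p) = |t| * eucNorm p := by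
  rw [eucNorm, eucNorm, ← Real.sqrt_sq (abs_nonneg t), ← Real.sqrt_mul (sq_nonneg _)]
  simp only [Prod.smul_fst, Prod.smul_snd, norm_smul, Real.norm_eq_abs]
  ring_nf

lemma isCompact_eucNorm_le (a : ℝ) : IsCompact {p : Esp n | eucNorm p ≤ a} := by
  refine (isCompact_closedBall (0 : Esp n) a).of_isClosed_subset
    (isClosed_le continuous_eucNorm continuous_const) fun p hp => ?_
  rw [mem_closedBall_zero_iff]
  exact (norm_le_eucNorm p).trans hp

/-- The standard symplectic form as a continuous bilinear map. -/
def symplCLM (n : ℕ) : Esp n →L[ℝ] Esp n →L[ℝ] ℝ :=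
  (innerSL ℝ).bilinearComp (.snd ℝ _ _) (.fst ℝ _ _)
    - ((innerSL ℝ).bilinearComp (.snd ℝ _ _) (.fst ℝ _ _)).flip

lemma symplCLM_apply (u v : Esp n) : symplCLM n u v = symplForm u v := by
  simp [symplCLM, symplForm]

lemma injective_symplCLM : Function.Injective (symplCLM n) := by
  rw [injective_iff_map_eq_zero]
  intro u hu
  have h := symplCLM_apply u (u.2, -u.1)
  rw [hu] at h
  simp only [symplForm, inner_neg_left, real_inner_self_eq_norm_sq, zero_apply] at h
  have h1 : ‖u.1‖ = 0 := by nlinarith [sq_nonneg ‖u.1‖, sq_nonneg ‖u.2‖]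
  have h2 : ‖u.2‖ = 0 := by nlinarith [sq_nonneg ‖u.1‖, sq_nonneg ‖u.2‖]
  exact Prod.ext (norm_eq_zero.1 h1) (norm_eq_zero.1 h2)

/-- Nondegeneracy of the standard symplectic form. -/
lemma exists_symplEquiv (n : ℕ) :
    ∃ Ω : Esp n ≃L[ℝ] (Esp n →L[ℝ] ℝ), ∀ u v, Ω u v = symplForm u v := by
  have hfin : Module.finrank ℝ (Esp n) = Module.finrank ℝ (Esp n →L[ℝ] ℝ) := by
    rw [← (LinearMap.toContinuousLinearMap (𝕜 := ℝ) (E := Esp n) (F' := ℝ)).finrank_eq]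
    exact Subspace.dual_finrank_eq.symm
  exact ⟨((symplCLM n).toLinearMap.linearEquivOfInjective injective_symplCLM hfin
    ).toContinuousLinearEquiv, symplCLM_apply⟩

end EuclideanBall

/-- a symplectic map `φ` of class `C¹` on the ball `B_R` can be approximated,
uniformly on the smaller ball `B_r` (with `r < R`) and within any given `ε > 0`, by a
symplectic map `ψ` of class `C^∞` defined on some ball `B_{R'}` with `R' > r`. -/
theorem stmt_4 (n : ℕ) (hn : 1 ≤ n) (R r ε : ℝ) (hr : 0 < r) (hrR : r < R) (hε : 0 < ε)
    (φ : Esp n → Esp n) (hC1 : ContDiffOn ℝ 1 φ (eucBall n R))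
    (hsymp : ∀ x ∈ eucBall n R, ∀ u v : Esp n,
      symplForm (fderiv ℝ φ x u) (fderiv ℝ φ x v) = symplForm u v) :
    ∃ (R' : ℝ) (ψ : Esp n → Esp n), r < R' ∧
      ContDiffOn ℝ ∞ ψ (eucBall n R') ∧
      (∀ x ∈ eucBall n R', ∀ u v : Esp n,
        symplForm (fderiv ℝ ψ x u) (fderiv ℝ ψ x v) = symplForm u v) ∧
      (∀ x ∈ eucBall n r, eucNorm (φ x - ψ x) ≤ ε) := by
  have : Nonempty (Fin n) := ⟨⟨0, hn⟩⟩
  obtain ⟨Ω, hΩ⟩ := exists_symplEquiv n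
  obtain ⟨r₁, hr₁, hr₁R⟩ := exists_between hrR
  obtain ⟨r₂, hr₂, hr₂R⟩ := exists_between hr₁R
  obtain ⟨ψ, hψ, h⟩ := exists_contDiff_symplectic_approx Ω
    (fun u v => by rw [hΩ, hΩ, symplForm, symplForm, neg_sub])
    (isOpen_lt continuous_eucNorm continuous_const) hC1
    (fun x hx u v => by rw [hΩ, hΩ]; exact hsymp x hx u v)
    (isCompact_eucNorm_le r₂) (fun x hx => lt_of_le_of_lt hx hr₂R)
    (fun x hx t ht => by
      rw [mem_ofPred_eq, eucNorm_smul, abs_of_nonneg ht.1]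
      exact (mul_le_of_le_one_left (Real.sqrt_nonneg _) ht.2).trans hx)
    (isCompact_eucNorm_le r₁)
    (fun x hx => mem_interior_iff_mem_nhds.2 <|
      (continuous_eucNorm.continuousAt.eventually_lt_const (lt_of_le_of_lt hx hr₂)).mono
        fun _ => le_of_lt)
    (half_pos hε)
  refine ⟨r₁, ψ, hr₁, hψ.contDiffOn, fun x hx u v => ?_, fun x hx => ?_⟩
  · simpa only [hΩ] using (h x (mem_ofPred_eq ▸ le_of_lt hx)).1 u v
  · have h1 := (h x (mem_ofPred_eq ▸ le_of_lt (lt_trans hx hr₁))).2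
    have h2 := eucNorm_le (φ x - ψ x)
    rw [norm_sub_rev] at h2
    linarith
end
end

section
/- Let T be a pretriangulated category satisfying the octahedral axiom. Suppose given a morphism a : A → B and two distinguished triangles C →^c B →^{c'} C' → C[1] and A →^{c'∘a} C' → D → A[1]. Then there exists a distinguished triangle A ⊕ C → B → D → (A ⊕ C)[1] whose first morphism A ⊕ C → B has components a and c. -/
open CategoryTheory CategoryTheory.Limits CategoryTheory.Pretriangulated

namespace CategoryTheory.Pretriangulated

variable {T : Type*} [Category T] [Preadditive T] [HasZeroObject T]
  [HasShift T ℤ] [∀ n : ℤ, (CategoryTheory.shiftFunctor T n).Additive]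
  [Pretriangulated T]

lemma mk_distinguished_of_iso {X Y Z X' Y' Z' : T}
    {f : X ⟶ Y} {g : Y ⟶ Z} {h : Z ⟶ X⟦(1 : ℤ)⟧}
    {f' : X' ⟶ Y'} {g' : Y' ⟶ Z'} {h' : Z' ⟶ X'⟦(1 : ℤ)⟧}
    (H : Triangle.mk f g h ∈ distTriang T) (e₁ : X' ≅ X) (e₂ : Y' ≅ Y) (e₃ : Z' ≅ Z)
    (comm₁ : f' ≫ e₂.hom = e₁.hom ≫ f) (comm₂ : g' ≫ e₃.hom = e₂.hom ≫ g)
    (comm₃ : h' ≫ e₁.hom⟦(1 : ℤ)⟧' = e₃.hom ≫ h) :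
    Triangle.mk f' g' h' ∈ distTriang T :=
  isomorphic_distinguished _ H _ (Triangle.isoMk _ _ e₁ e₂ e₃ comm₁ comm₂ comm₃)

lemma biprod_inr_fst_distinguished [HasBinaryBiproducts T] (X Y : T) :
    Triangle.mk (biprod.inr : Y ⟶ X ⊞ Y) biprod.fst (0 : X ⟶ Y⟦(1 : ℤ)⟧) ∈ distTriang T :=
  mk_distinguished_of_iso (binaryBiproductTriangle_distinguished Y X)
    (Iso.refl Y) (biprod.braiding X Y) (Iso.refl X) (by ext <;> simp) (by simp) (by simp)

end CategoryTheory.Pretriangulated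

/-- in a (pre)triangulated category satisfying the octahedral axiom, given a
morphism `a : A ⟶ B` and distinguished triangles `C → B → C' → C[1]` and
`A → C' → D → A[1]` (with first map `c' ∘ a`), there is a distinguished triangle
`A ⊕ C → B → D → (A ⊕ C)[1]` whose first morphism has components `a` and `c`. -/
theorem stmt_14 {T : Type*} [Category T] [Preadditive T] [HasZeroObject T]
    [HasShift T ℤ] [∀ n : ℤ, (CategoryTheory.shiftFunctor T n).Additive]
    [Pretriangulated T] [IsTriangulated T] [HasBinaryBiproducts T]
    {A B C C' D : T} (a : A ⟶ B) (c : C ⟶ B) (c' : B ⟶ C')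
    (w : C' ⟶ C⟦(1:ℤ)⟧) (hT1 : Triangle.mk c c' w ∈ distTriang T)
    (d1 : C' ⟶ D) (d2 : D ⟶ A⟦(1:ℤ)⟧)
    (hT2 : Triangle.mk (a ≫ c') d1 d2 ∈ distTriang T) :
    ∃ (g : B ⟶ D) (h : D ⟶ (A ⊞ C)⟦(1:ℤ)⟧),
      Triangle.mk (biprod.desc a c) g h ∈ distTriang T := by
  obtain ⟨E, g, h, hE⟩ := distinguished_cocone_triangle (biprod.desc a c)
  let o := Triangulated.someOctahedron (biprod.inr_desc a c)
    (biprod_inr_fst_distinguished A C) hE hT1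
  have hm₁ : o.m₁ = a ≫ c' := by
    simpa using biprod.inl ≫= o.comm₁
  have ho := o.mem
  rw [hm₁] at ho
  let e : E ≅ D := Triangle.π₃.mapIso
    (isoTriangleOfIso₁₂ _ _ ho hT2 (Iso.refl A) (Iso.refl C')
      ((Category.comp_id _).trans (Category.id_comp _).symm))
  exact ⟨g ≫ e.hom, e.inv ≫ h, mk_distinguished_of_iso hE (Iso.refl _) (Iso.refl _) e.symm
    (by simp) (by simp) (by simp)⟩
end

section
/- Let d ≥ 1, let a ≤ b be real numbers and let C = [a,b]^d be the compact cube in ℝ^d. Let {U_i}_{i∈I} be a family of open subsets of ℝ^d such that C ⊆ ⋃_{i∈I} U_i. Then there exists a finite sequence of open subsets V_1, …, V_N of ℝ^d such that: (i) for each n = 1,…,N there exists i ∈ I with V_n ⊆ U_i; (ii) C ⊆ ⋃_{n=1}^N V_n; (iii) for each n = 1,…,N−1 the set (⋃_{k=1}^{n} V_k) ∩ V_{n+1} is nonempty and contractible. -/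
/-- The open sup-norm ball of radius `h` around the grid point `(a + k i * h)_i`. -/
def gridCube {d : ℕ} (a h : ℝ) (k : Fin d → ℕ) : Set (EuclideanSpace ℝ (Fin d)) :=
  {x | ∀ i, a + k i * h - h < x i ∧ x i < a + k i * h + h}

theorem isOpen_gridCube {d : ℕ} (a h : ℝ) (k : Fin d → ℕ) : IsOpen (gridCube a h k) := by
  simp only [gridCube, Set.ofPred_forall]
  refine isOpen_iInter_of_finite fun i => ?_
  exact isOpen_Ioo.preimage (f := fun x : EuclideanSpace ℝ (Fin d) => x i) (by fun_prop)

theorem monotone_finFunctionFinEquiv (M d : ℕ) :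
    Monotone (finFunctionFinEquiv : (Fin d → Fin M) → Fin (M ^ d)) := by
  intro k k' hk
  rw [Fin.le_def, finFunctionFinEquiv_apply, finFunctionFinEquiv_apply]
  gcongr with i
  exact hk i

/-- The points of the cube with index `k` lying below its center in some coordinate `j`
with `0 < k j`. -/
def gridCubeLower {d : ℕ} (a h : ℝ) (k : Fin d → ℕ) : Set (EuclideanSpace ℝ (Fin d)) :=
  {x | x ∈ gridCube a h k ∧ ∃ j, 0 < k j ∧ x j < a + k j * h}

theorem mem_gridCubeLower {d : ℕ} {a h : ℝ} (hh : 0 < h) {k : Fin d → ℕ} (hk : ∃ j, 0 < k j) :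
    WithLp.toLp 2 (fun i => a + k i * h - h / 2) ∈ gridCubeLower a h k := by
  refine ⟨fun i => ⟨?_, ?_⟩, hk.imp fun j hj => ⟨hj, ?_⟩⟩ <;> dsimp only <;> linarith

theorem starConvex_gridCubeLower {d : ℕ} {a h : ℝ} (hh : 0 < h) (k : Fin d → ℕ) :
    StarConvex ℝ (WithLp.toLp 2 (fun i => a + k i * h - h / 2)) (gridCubeLower a h k) := by
  rintro x ⟨hx, j, hj, hxj⟩ s t hs ht hst
  refine ⟨fun i => ?_, j, hj, ?_⟩
  · exact (convex_Ioo (a + k i * h - h) (a + k i * h + h))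
      (x := a + k i * h - h / 2) ⟨by linarith, by linarith⟩ (hx i) hs ht hst
  · exact (convex_Iio (a + k j * h)) (x := a + k j * h - h / 2)
      (Set.mem_Iio.2 (by linarith)) hxj hs ht hst

theorem iUnion_gridCube_inter_gridCube {d M : ℕ} (a : ℝ) {h : ℝ} (hh : 0 < h)
    (n : Fin (M ^ d)) :
    (⋃ (l : Fin (M ^ d)) (_ : l < n), gridCube a h (fun i => finFunctionFinEquiv.symm l i)) ∩
      gridCube a h (fun i => finFunctionFinEquiv.symm n i) =
    gridCubeLower a h (fun i : Fin d => (finFunctionFinEquiv.symm n i : ℕ)) := by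
  ext x
  simp only [Set.mem_inter_iff, Set.mem_iUnion, exists_prop]
  constructor
  · rintro ⟨⟨l, hl, hxl⟩, hxn⟩
    have hlt : ∃ j, finFunctionFinEquiv.symm l j < finFunctionFinEquiv.symm n j := by
      by_contra! hle
      have := monotone_finFunctionFinEquiv M d hle
      simp only [Equiv.apply_symm_apply] at this
      exact this.not_gt hl
    obtain ⟨j, hj⟩ := hlt
    refine ⟨hxn, j, (Nat.zero_le _).trans_lt hj, (hxl j).2.trans_le ?_⟩
    have : ((finFunctionFinEquiv.symm l j : ℕ) : ℝ) + 1 ≤ (finFunctionFinEquiv.symm n j : ℕ) := by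
      exact_mod_cast hj
    nlinarith
  · rintro ⟨hxn, j, hj, hxj⟩
    refine ⟨?_, hxn⟩
    set k := finFunctionFinEquiv.symm n with hk
    let c : Fin M := ⟨k j - 1, (Nat.sub_le _ _).trans_lt (k j).2⟩
    have hc : ((c : ℕ) : ℝ) + 1 = (k j : ℕ) := by
      exact_mod_cast Nat.sub_add_cancel hj
    have hle : Function.update k j c ≤ k := by
      rw [update_le_self_iff]
      exact Nat.sub_le _ _
    have hne : Function.update k j c ≠ k := by
      intro he
      have := congrArg (fun f => ((f j : ℕ) : ℝ)) he
      simp only [Function.update_self] at this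
      linarith
    refine ⟨finFunctionFinEquiv (Function.update k j c), ?_, ?_⟩
    · refine lt_of_le_of_ne ?_ ?_
      · simpa [hk] using monotone_finFunctionFinEquiv M d hle
      · rwa [Ne, ← Equiv.eq_symm_apply]
    · intro i
      rw [Equiv.symm_apply_apply]
      rcases eq_or_ne i j with rfl | hij
      · have := hxn i
        simp only [Function.update_self]
        rw [← hc] at this hxj
        constructor <;> nlinarith
      · simpa [Function.update_of_ne hij] using hxn i

/-- A fine grid of cubes around points of `[a, b]^d` refines any open cover. -/
theorem exists_gridCube_subset {d : ℕ} {a b : ℝ} {ι : Type*}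
    {U : ι → Set (EuclideanSpace ℝ (Fin d))} (hUopen : ∀ i, IsOpen (U i))
    (hcov : {x : EuclideanSpace ℝ (Fin d) | ∀ i, x i ∈ Set.Icc a b} ⊆ ⋃ i, U i) :
    ∃ h > 0, ∀ k : Fin d → ℕ, (∀ i, a + k i * h ≤ b) → ∃ i, gridCube a h k ⊆ U i := by
  have hcont : Continuous (WithLp.toLp 2 : (Fin d → ℝ) → EuclideanSpace ℝ (Fin d)) :=
    PiLp.continuous_toLp 2 _
  obtain ⟨h, hh, H⟩ := lebesgue_number_lemma_of_metric
    (isCompact_univ_pi fun _ : Fin d => isCompact_Icc (a := a) (b := b))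
    (fun i => (hUopen i).preimage hcont)
    (fun x hx => by
      rw [← Set.preimage_iUnion]
      exact hcov fun i => hx i (Set.mem_univ i))
  refine ⟨h, hh, fun k hk => ?_⟩
  obtain ⟨i, hi⟩ := H (fun i => a + k i * h)
    fun i _ => ⟨le_add_of_nonneg_right (by positivity), hk i⟩
  refine ⟨i, fun x hx => hi (a := WithLp.ofLp x) ?_⟩
  rw [Metric.mem_ball, dist_pi_lt_iff hh]
  intro j
  rw [Real.dist_eq, abs_lt]
  have := hx j
  constructor <;> linarith


/-- a compact cube `C = [a,b]^d ⊆ ℝ^d` covered by a family of open sets `U i`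
admits a finite refinement `V 1, …, V N` by open sets, each contained in some `U i`,
still covering `C`, and such that `(V 1 ∪ ⋯ ∪ V m) ∩ V (m+1)` is nonempty and contractible
for every `m`. -/
theorem stmt_17 (d : ℕ) (hd : 1 ≤ d) (a b : ℝ) (hab : a ≤ b)
    {ι : Type*} (U : ι → Set (EuclideanSpace ℝ (Fin d)))
    (hUopen : ∀ i, IsOpen (U i))
    (hcov : {x : EuclideanSpace ℝ (Fin d) | ∀ i, x i ∈ Set.Icc a b} ⊆ ⋃ i, U i) :
    ∃ (N : ℕ) (V : Fin N → Set (EuclideanSpace ℝ (Fin d))),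
      (∀ m, IsOpen (V m)) ∧
      (∀ m, ∃ i, V m ⊆ U i) ∧
      ({x : EuclideanSpace ℝ (Fin d) | ∀ i, x i ∈ Set.Icc a b} ⊆ ⋃ m, V m) ∧
      ∀ (m : ℕ) (h : m + 1 < N),
        ((⋃ (l : Fin N) (_ : (l : ℕ) ≤ m), V l) ∩ V ⟨m + 1, h⟩).Nonempty ∧
        ContractibleSpace ↥((⋃ (l : Fin N) (_ : (l : ℕ) ≤ m), V l) ∩ V ⟨m + 1, h⟩) := by
  obtain ⟨h, hh, hU⟩ := exists_gridCube_subset hUopen hcov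
  set M := ⌊(b - a) / h⌋₊ + 1 with hM
  refine ⟨M ^ d, fun n => gridCube a h (fun i => finFunctionFinEquiv.symm n i),
    fun n => isOpen_gridCube _ _ _, fun n => hU _ fun i => ?_, fun x hx => ?_, fun m hm => ?_⟩
  · have h1 := Nat.le_of_lt_succ (finFunctionFinEquiv.symm n i).2
    rw [Nat.le_floor_iff (div_nonneg (sub_nonneg.2 hab) hh.le), le_div_iff₀ hh] at h1
    linarith
  · have hlt : ∀ i, ⌊(x i - a) / h⌋₊ < M := fun i => by
      rw [hM, Nat.lt_succ_iff]
      gcongr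
      exact (hx i).2
    refine Set.mem_iUnion.2 ⟨finFunctionFinEquiv fun i => ⟨_, hlt i⟩, fun i => ?_⟩
    simp only [Equiv.symm_apply_apply]
    have h1 := Nat.floor_le (div_nonneg (sub_nonneg.2 (hx i).1) hh.le)
    have h2 := Nat.lt_floor_add_one ((x i - a) / h)
    rw [le_div_iff₀ hh] at h1
    rw [div_lt_iff₀ hh] at h2
    constructor <;> linarith
  · have hset := iUnion_gridCube_inter_gridCube (d := d) (M := M) a hh ⟨m + 1, hm⟩
    simp only [Fin.lt_def, Nat.lt_succ_iff] at hset
    rw [hset]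
    have hpos : ∃ j : Fin d, 0 < (finFunctionFinEquiv.symm (⟨m + 1, hm⟩ : Fin (M ^ d)) j : ℕ) := by
      by_contra! h0
      have h1 := finFunctionFinEquiv_apply (finFunctionFinEquiv.symm (⟨m + 1, hm⟩ : Fin (M ^ d)))
      simp only [Equiv.apply_symm_apply, Nat.le_zero.1 (h0 _), zero_mul,
        Finset.sum_const_zero] at h1
      omega
    have hne : (gridCubeLower a h fun i : Fin d =>
        (finFunctionFinEquiv.symm (⟨m + 1, hm⟩ : Fin (M ^ d)) i : ℕ)).Nonempty :=
      ⟨_, mem_gridCubeLower hh hpos⟩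
    exact ⟨hne, (starConvex_gridCubeLower hh _).contractibleSpace hne⟩
end
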